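/- arXiv:1904.07381 — 14 statements merged into one kernel-verified Lean document; each statement's English description precedes it below -/
import Mathlib

section
/- Let X ⊆ ℝ^m_{≥0} with 0 ∈ X, and suppose g(0,A) ≤ g(x,A) + λ·(c·x) for all x ∈ X and A ∈ 𝒜 (property (P2)), where λ ≥ 1. Let ζ_max := max_{A,A'∈𝒜} ζ(A,A') and Λ := max{ λ, ζ_max/r }. Then for every x ∈ X, every y ≥ 0 and every A ∈ 𝒜: g(0,0,A) ≤ g(x,y,A) + Λ·(c·x + r·y). -/
open Finset

/-- Under property (P2) with inflation parameter `λ ≥ 1`, with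
`ζ_max := max_{A,A'} ζ(A,A')` and `Λ := max(λ, ζ_max / r)`, one has for every `x ∈ X`,
`y ≥ 0` and scenario `A`: `g(0,0,A) ≤ g(x,y,A) + Λ·(c·x + r·y)`. -/
theorem stmt1 {m : ℕ} {𝒜 : Type*} [Fintype 𝒜] [Nonempty 𝒜]
    (ζ : 𝒜 → 𝒜 → ℝ) (hζnn : ∀ A A', 0 ≤ ζ A A') (hζ0 : ∀ A, ζ A A = 0)
    (r : ℝ) (hr : 0 < r)
    (c : Fin m → ℝ) (hc : ∀ i, 0 ≤ c i)
    (g : (Fin m → ℝ) → 𝒜 → ℝ)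
    (X : Set (Fin m → ℝ)) (hXnn : ∀ x ∈ X, ∀ i, 0 ≤ x i) (hX0 : (0 : Fin m → ℝ) ∈ X)
    (lam : ℝ) (hlam : 1 ≤ lam)
    (hP2 : ∀ x ∈ X, ∀ A : 𝒜, g 0 A ≤ g x A + lam * ∑ i, c i * x i)
    (ζmax : ℝ) (hζmax : IsGreatest {v | ∃ A A' : 𝒜, v = ζ A A'} ζmax)
    (gxy : (Fin m → ℝ) → ℝ → 𝒜 → ℝ)
    (hgxy : ∀ x y A, IsGreatest {v | ∃ A' : 𝒜, v = g x A' - y * ζ A A'} (gxy x y A)) :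
    ∀ x ∈ X, ∀ y : ℝ, 0 ≤ y → ∀ A : 𝒜,
      gxy 0 0 A ≤ gxy x y A + max lam (ζmax / r) * ((∑ i, c i * x i) + r * y) := by
  intro x hx y hy A
  obtain ⟨B, hB⟩ := (hgxy 0 0 A).1
  have h1 : g x B - y * ζ A B ≤ gxy x y A := (hgxy x y A).2 ⟨B, rfl⟩
  have h2 : ζ A B ≤ ζmax := hζmax.2 ⟨A, B, rfl⟩
  have h3 := hP2 x hx B
  have hS : 0 ≤ ∑ i, c i * x i :=
    Finset.sum_nonneg fun i _ => mul_nonneg (hc i) (hXnn x hx i)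
  have h4 : lam * ∑ i, c i * x i ≤ max lam (ζmax / r) * ∑ i, c i * x i :=
    mul_le_mul_of_nonneg_right (le_max_left _ _) hS
  have h5 : ζmax / r * (r * y) ≤ max lam (ζmax / r) * (r * y) :=
    mul_le_mul_of_nonneg_right (le_max_right _ _) (mul_nonneg hr.le hy)
  have h6 : ζmax / r * (r * y) = y * ζmax := by
    field_simp
  have h7 : y * ζ A B ≤ y * ζmax := mul_le_mul_of_nonneg_left h2 hy
  rw [mul_add, hB]
  linarith
end

section
/- Let λ ≥ 1 and M := λ·r. Define Z^short_p(x) as the maximum of ∑_{A,A'} γ(A,A')·g(x,A') over transportation plans γ feasible for (p,r) that additionally satisfy γ(A,A') = 0 whenever ζ(A,A') > M, and Z^long_p(x) as the maximum of the same objective over transportation plans γ feasible for (p,r) that additionally satisfy ∑_{A,A'} γ(A,A') ≤ 1/λ. Let P ⊆ ℝ^m_{≥0} with 0 ∈ P, and suppose that for all x ∈ P and A ∈ 𝒜: 0 ≤ g(x,A) ≤ g(0,A) (property (P1)) and g(0,A) ≤ g(x,A) + λ·(c·x) (property (P2)). Then for every x ∈ P: h_p(x) ≤ c·x + Z^short_p(x)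 + Z^long_p(0) ≤ 2·h_p(x). -/
open Finset

/-- With `M := λ·r`, decomposing `Z_p` into the short-edge part `Z^short_p`
and the long-edge part `Z^long_p`, under properties (P1) and (P2) one has, for every
`x ∈ P`: `h_p(x) ≤ c·x + Z^short_p(x) + Z^long_p(0) ≤ 2·h_p(x)`. -/
theorem stmt2 {m : ℕ} {𝒜 : Type*} [Fintype 𝒜] [Nonempty 𝒜]
    (ζ : 𝒜 → 𝒜 → ℝ) (hζnn : ∀ A A', 0 ≤ ζ A A') (hζ0 : ∀ A, ζ A A = 0)
    (r : ℝ) (hr : 0 < r)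
    (p : 𝒜 → ℝ) (hp : ∀ A, 0 ≤ p A) (hp1 : ∑ A, p A = 1)
    (c : Fin m → ℝ) (hc : ∀ i, 0 ≤ c i)
    (g : (Fin m → ℝ) → 𝒜 → ℝ)
    (lam : ℝ) (hlam : 1 ≤ lam)
    (P : Set (Fin m → ℝ)) (hPnn : ∀ x ∈ P, ∀ i, 0 ≤ x i) (hP0 : (0 : Fin m → ℝ) ∈ P)
    (hP1 : ∀ x ∈ P, ∀ A : 𝒜, 0 ≤ g x A ∧ g x A ≤ g 0 A)
    (hP2 : ∀ x ∈ P, ∀ A : 𝒜, g 0 A ≤ g x A + lam * ∑ i, c i * x i)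
    (Z Zshort : (Fin m → ℝ) → ℝ) (Zlong0 : ℝ)
    (hZ : ∀ x : Fin m → ℝ, IsGreatest {v | ∃ γ : 𝒜 → 𝒜 → ℝ,
        (∀ A A', 0 ≤ γ A A') ∧ (∀ A, ∑ A', γ A A' ≤ p A) ∧
        (∑ A, ∑ A', ζ A A' * γ A A' ≤ r) ∧
        v = ∑ A, ∑ A', γ A A' * g x A'} (Z x))
    (hZshort : ∀ x : Fin m → ℝ, IsGreatest {v | ∃ γ : 𝒜 → 𝒜 → ℝ,
        (∀ A A', 0 ≤ γ A A') ∧ (∀ A, ∑ A', γ A A' ≤ p A) ∧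
        (∑ A, ∑ A', ζ A A' * γ A A' ≤ r) ∧
        (∀ A A', lam * r < ζ A A' → γ A A' = 0) ∧
        v = ∑ A, ∑ A', γ A A' * g x A'} (Zshort x))
    (hZlong0 : IsGreatest {v | ∃ γ : 𝒜 → 𝒜 → ℝ,
        (∀ A A', 0 ≤ γ A A') ∧ (∀ A, ∑ A', γ A A' ≤ p A) ∧
        (∑ A, ∑ A', ζ A A' * γ A A' ≤ r) ∧
        (∑ A, ∑ A', γ A A' ≤ 1 / lam) ∧
        v = ∑ A, ∑ A', γ A A' * g 0 A'} Zlong0) :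
    ∀ x ∈ P,
      (∑ i, c i * x i) + Z x ≤ (∑ i, c i * x i) + Zshort x + Zlong0 ∧
      (∑ i, c i * x i) + Zshort x + Zlong0 ≤ 2 * ((∑ i, c i * x i) + Z x) := by
  classical
  intro x hx
  constructor
  · obtain ⟨⟨γ, h0, h1, h2, h3⟩, -⟩ := hZ x
    have hs := (hZshort x).2 ⟨fun A A' => if lam * r < ζ A A' then 0 else γ A A', ?_, ?_, ?_, ?_, rfl⟩
    · have hl := hZlong0.2 ⟨fun A A' => if lam * r < ζ A A' then γ A A' else 0, ?_, ?_, ?_, ?_, rfl⟩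
      · have key : Z x ≤ (∑ A, ∑ A', (if lam * r < ζ A A' then 0 else γ A A') * g x A')
            + ∑ A, ∑ A', (if lam * r < ζ A A' then γ A A' else 0) * g 0 A' := by
          rw [h3, ← Finset.sum_add_distrib]
          refine Finset.sum_le_sum fun A _ => ?_
          rw [← Finset.sum_add_distrib]
          refine Finset.sum_le_sum fun A' _ => ?_
          have := mul_le_mul_of_nonneg_left (hP1 x hx A').2 (h0 A A')
          split_ifs <;> simp [this]
        linarith
      · intro A A'
        have := h0 A A'
        dsimp only
        split_ifs <;> simp [this]
      · intro A
        refine (Finset.sum_le_sum fun A' _ => ?_).trans (h1 A)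
        have := h0 A A'
        dsimp only
        split_ifs <;> simp [this]
      · refine (Finset.sum_le_sum fun A _ => Finset.sum_le_sum fun A' _ => ?_).trans h2
        have := mul_nonneg (hζnn A A') (h0 A A')
        dsimp only
        split_ifs <;> simp [this]
      · have hm : (lam * r) * (∑ A, ∑ A', (if lam * r < ζ A A' then γ A A' else 0)) ≤ r := by
          rw [Finset.mul_sum]
          simp_rw [Finset.mul_sum]
          refine (Finset.sum_le_sum fun A _ => Finset.sum_le_sum fun A' _ => ?_).trans h2
          split_ifs with h
          · exact mul_le_mul_of_nonneg_right h.le (h0 A A')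
          · simpa using mul_nonneg (hζnn A A') (h0 A A')
        rw [le_div_iff₀ (by linarith)]
        refine le_of_mul_le_mul_left ?_ hr
        linarith
    · intro A A'
      have := h0 A A'
      dsimp only
      split_ifs <;> simp [this]
    · intro A
      refine (Finset.sum_le_sum fun A' _ => ?_).trans (h1 A)
      have := h0 A A'
      dsimp only
      split_ifs <;> simp [this]
    · refine (Finset.sum_le_sum fun A _ => Finset.sum_le_sum fun A' _ => ?_).trans h2
      have := mul_nonneg (hζnn A A') (h0 A A')
      dsimp only
      split_ifs <;> simp [this]
    · intro A A' h
      simp [h]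
  · have hs : Zshort x ≤ Z x := by
      obtain ⟨⟨γ, h0, h1, h2, -, h3⟩, -⟩ := hZshort x
      exact (hZ x).2 ⟨γ, h0, h1, h2, h3⟩
    obtain ⟨⟨γ, h0, h1, h2, h4, h3⟩, -⟩ := hZlong0
    have hz := (hZ x).2 ⟨γ, h0, h1, h2, rfl⟩
    have hcx : 0 ≤ ∑ i, c i * x i :=
      Finset.sum_nonneg fun i _ => mul_nonneg (hc i) (hPnn x hx i)
    have hl : Zlong0 ≤ (∑ A, ∑ A', γ A A' * g x A')
        + (∑ A, ∑ A', γ A A') * (lam * ∑ i, c i * x i) := by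
      rw [h3, Finset.sum_mul, ← Finset.sum_add_distrib]
      refine Finset.sum_le_sum fun A _ => ?_
      rw [Finset.sum_mul, ← Finset.sum_add_distrib]
      refine Finset.sum_le_sum fun A' _ => ?_
      rw [← mul_add]
      exact mul_le_mul_of_nonneg_left (hP2 x hx A') (h0 A A')
    have hb : (∑ A, ∑ A', γ A A') * (lam * ∑ i, c i * x i) ≤ ∑ i, c i * x i := by
      rw [le_div_iff₀ (by linarith)] at h4
      rw [← mul_assoc]
      exact mul_le_of_le_one_left hcx h4
    linarith
end

section
/- Let P ⊆ ℝ^m_{≥0}, fix x ∈ P and β ≥ 1. Suppose for each A' ∈ 𝒜 there is a vector s^{A'} ∈ ℝ^m that is a subgradient of g(·,A') at x over P, i.e. g(v,A') − g(x,A') ≥ s^{A'}·(v − x) for all v ∈ P. Let γ be a transportation plan feasible for (p,r) with β·∑_{A,A'} γ(A,A')·g(x,A') ≥ Z_p(x). Then d := c + ∑_{A,A'} γ(A,A')·s^{A'} is a (1 − 1/β)-subgradient of h_p at x over P, i.e. h_p(x') − h_p(x) ≥ d·(x' − x) − (1 − 1/β)·h_p(x) for every x' ∈ P. -/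
open Finset

/-- If `s^{A'}` are subgradients of `g(·,A')` at `x` over `P` and `γ` is a
`β`-approximate solution to the transportation LP defining `Z_p(x)`, then
`d := c + ∑_{A,A'} γ(A,A')·s^{A'}` is a `(1 − 1/β)`-subgradient of `h_p` at `x` over `P`. -/
theorem stmt4 {m : ℕ} {𝒜 : Type*} [Fintype 𝒜] [Nonempty 𝒜]
    (ζ : 𝒜 → 𝒜 → ℝ) (hζnn : ∀ A A', 0 ≤ ζ A A') (hζ0 : ∀ A, ζ A A = 0)
    (r : ℝ) (hr : 0 < r)
    (p : 𝒜 → ℝ) (hp : ∀ A, 0 ≤ p A) (hp1 : ∑ A, p A = 1)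
    (c : Fin m → ℝ) (hc : ∀ i, 0 ≤ c i)
    (g : (Fin m → ℝ) → 𝒜 → ℝ)
    (P : Set (Fin m → ℝ)) (hPnn : ∀ u ∈ P, ∀ i, 0 ≤ u i)
    (x : Fin m → ℝ) (hx : x ∈ P)
    (β : ℝ) (hβ : 1 ≤ β)
    (s : 𝒜 → (Fin m → ℝ))
    (hs : ∀ (A' : 𝒜), ∀ v ∈ P, (∑ i, s A' i * (v i - x i)) ≤ g v A' - g x A')
    (γ : 𝒜 → 𝒜 → ℝ)
    (hγnn : ∀ A A', 0 ≤ γ A A') (hγp : ∀ A, ∑ A', γ A A' ≤ p A)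
    (hγr : ∑ A, ∑ A', ζ A A' * γ A A' ≤ r)
    (Z : (Fin m → ℝ) → ℝ)
    (hZ : ∀ u : Fin m → ℝ, IsGreatest {v | ∃ γ' : 𝒜 → 𝒜 → ℝ,
        (∀ A A', 0 ≤ γ' A A') ∧ (∀ A, ∑ A', γ' A A' ≤ p A) ∧
        (∑ A, ∑ A', ζ A A' * γ' A A' ≤ r) ∧
        v = ∑ A, ∑ A', γ' A A' * g u A'} (Z u))
    (happrox : Z x ≤ β * ∑ A, ∑ A', γ A A' * g x A') :
    ∀ x' ∈ P,
      (∑ i, (c i + ∑ A, ∑ A', γ A A' * s A' i) * (x' i - x i))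
          - (1 - 1 / β) * ((∑ i, c i * x i) + Z x)
        ≤ ((∑ i, c i * x' i) + Z x') - ((∑ i, c i * x i) + Z x) := by
  intro x' hx'
  have hβ0 : 0 < β := by linarith
  have h1 : ∑ A, ∑ A', γ A A' * g x' A' ≤ Z x' :=
    (hZ x').2 ⟨γ, hγnn, hγp, hγr, rfl⟩
  have h2 : ∑ A, ∑ A', γ A A' * (∑ i, s A' i * (x' i - x i))
      ≤ ∑ A, ∑ A', γ A A' * (g x' A' - g x A') :=
    Finset.sum_le_sum fun A _ => Finset.sum_le_sum fun A' _ =>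
      mul_le_mul_of_nonneg_left (hs A' x' hx') (hγnn A A')
  have h3 : ∑ A, ∑ A', γ A A' * (g x' A' - g x A')
      = ∑ A, ∑ A', γ A A' * g x' A' - ∑ A, ∑ A', γ A A' * g x A' := by
    simp only [mul_sub, Finset.sum_sub_distrib]
  have h4 : ∑ i, (c i + ∑ A, ∑ A', γ A A' * s A' i) * (x' i - x i)
      = (∑ i, c i * x' i) - (∑ i, c i * x i)
        + ∑ A, ∑ A', γ A A' * (∑ i, s A' i * (x' i - x i)) := by
    simp only [add_mul, Finset.sum_add_distrib]
    congr 1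
    · simp only [mul_sub, Finset.sum_sub_distrib]
    · simp only [Finset.sum_mul, Finset.mul_sum]
      rw [Finset.sum_comm]
      refine Finset.sum_congr rfl fun A _ => ?_
      rw [Finset.sum_comm]
      refine Finset.sum_congr rfl fun A' _ => Finset.sum_congr rfl fun i _ => ?_
      ring
  have h5 : 1 / β * Z x ≤ ∑ A, ∑ A', γ A A' * g x A' := by
    rw [one_div, inv_mul_le_iff₀ hβ0]
    exact happrox
  have h6 : 0 ≤ ∑ i, c i * x i :=
    Finset.sum_nonneg fun i _ => mul_nonneg (hc i) (hPnn x hx i)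
  have h7 : 1 / β ≤ 1 := by
    rw [div_le_one hβ0]
    exact hβ
  have h8 : 0 ≤ (1 - 1 / β) * ∑ i, c i * x i := mul_nonneg (by linarith) h6
  rw [h4, mul_add]
  have h9 : (1 - 1 / β) * Z x = Z x - 1 / β * Z x := by ring
  rw [h9]
  linarith
end

section
/- Let P ⊆ ℝ^m_{≥0} and ρ, β ≥ 1. Fix x̄ ∈ P and x̃ ∈ P such that c·x̃ ≤ ρ·(c·x̄) and g(x̃,A) ≤ ρ·g(x̄,A) for every A ∈ 𝒜. Suppose for each A' ∈ 𝒜 there is a vector s^{A'} ∈ ℝ^m that is a subgradient of g(·,A') at x̄ over P (g(v,A') − g(x̄,A') ≥ s^{A'}·(v − x̄) for all v ∈ P). Let γ be a transportation plan feasible for (p,r) with β·∑_{A,A'} γ(A,A')·g(x̃,A') ≥ Z_p(x̃), and set s̃ := c + ∑_{A,A'} γ(A,A')·s^{A'}. Then for every x' ∈ P with s̃·(x' − x̄) ≥ 0: h_p(x') ≥ (1/ρ)·( c·x̃ + ∑_{A,A'} γ(A,A')·g(x̃,A') ) ≥ h_p(x̃)/(β·ρ). -/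
open Finset

/-- If `x̃` is a local `ρ`-approximate rounding of `x̄`, the `s^{A'}` are
subgradients of `g(·,A')` at `x̄` over `P`, and `γ` is a `β`-approximate solution to the
transportation LP defining `Z_p(x̃)`, then with `s̃ := c + ∑ γ(A,A')·s^{A'}`, every
`x' ∈ P` with `s̃·(x' − x̄) ≥ 0` satisfies
`h_p(x') ≥ (1/ρ)(c·x̃ + ∑ γ(A,A')·g(x̃,A')) ≥ h_p(x̃)/(βρ)`. -/
theorem stmt5 {m : ℕ} {𝒜 : Type*} [Fintype 𝒜] [Nonempty 𝒜]
    (ζ : 𝒜 → 𝒜 → ℝ) (hζnn : ∀ A A', 0 ≤ ζ A A') (hζ0 : ∀ A, ζ A A = 0)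
    (r : ℝ) (hr : 0 < r)
    (p : 𝒜 → ℝ) (hp : ∀ A, 0 ≤ p A) (hp1 : ∑ A, p A = 1)
    (c : Fin m → ℝ) (hc : ∀ i, 0 ≤ c i)
    (g : (Fin m → ℝ) → 𝒜 → ℝ)
    (P : Set (Fin m → ℝ)) (hPnn : ∀ u ∈ P, ∀ i, 0 ≤ u i)
    (ρ β : ℝ) (hρ : 1 ≤ ρ) (hβ : 1 ≤ β)
    (xbar xtil : Fin m → ℝ) (hxbar : xbar ∈ P) (hxtil : xtil ∈ P)
    (hloc1 : (∑ i, c i * xtil i) ≤ ρ * ∑ i, c i * xbar i)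
    (hloc2 : ∀ A : 𝒜, g xtil A ≤ ρ * g xbar A)
    (s : 𝒜 → (Fin m → ℝ))
    (hs : ∀ (A' : 𝒜), ∀ v ∈ P, (∑ i, s A' i * (v i - xbar i)) ≤ g v A' - g xbar A')
    (γ : 𝒜 → 𝒜 → ℝ)
    (hγnn : ∀ A A', 0 ≤ γ A A') (hγp : ∀ A, ∑ A', γ A A' ≤ p A)
    (hγr : ∑ A, ∑ A', ζ A A' * γ A A' ≤ r)
    (Z : (Fin m → ℝ) → ℝ)
    (hZ : ∀ u : Fin m → ℝ, IsGreatest {v | ∃ γ' : 𝒜 → 𝒜 → ℝ,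
        (∀ A A', 0 ≤ γ' A A') ∧ (∀ A, ∑ A', γ' A A' ≤ p A) ∧
        (∑ A, ∑ A', ζ A A' * γ' A A' ≤ r) ∧
        v = ∑ A, ∑ A', γ' A A' * g u A'} (Z u))
    (happrox : Z xtil ≤ β * ∑ A, ∑ A', γ A A' * g xtil A') :
    ∀ x' ∈ P,
      0 ≤ ∑ i, (c i + ∑ A, ∑ A', γ A A' * s A' i) * (x' i - xbar i) →
      (1 / ρ) * ((∑ i, c i * xtil i) + ∑ A, ∑ A', γ A A' * g xtil A')
          ≤ (∑ i, c i * x' i) + Z x' ∧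
      ((∑ i, c i * xtil i) + Z xtil) / (β * ρ)
          ≤ (1 / ρ) * ((∑ i, c i * xtil i) + ∑ A, ∑ A', γ A A' * g xtil A') := by
  intro x' hx' h0
  have hρ0 : 0 < ρ := by linarith
  have hβ0 : 0 < β := by linarith
  have hC : 0 ≤ ∑ i, c i * xtil i :=
    Finset.sum_nonneg fun i _ => mul_nonneg (hc i) (hPnn xtil hxtil i)
  have hG : ∑ A, ∑ A', γ A A' * g xtil A' ≤ ρ * ∑ A, ∑ A', γ A A' * g xbar A' := by
    rw [Finset.mul_sum]
    refine Finset.sum_le_sum fun A _ => ?_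
    rw [Finset.mul_sum]
    refine Finset.sum_le_sum fun A' _ => ?_
    have := mul_le_mul_of_nonneg_left (hloc2 A') (hγnn A A')
    linarith
  have hZ' : ∑ A, ∑ A', γ A A' * g x' A' ≤ Z x' :=
    (hZ x').2 ⟨γ, hγnn, hγp, hγr, rfl⟩
  have hsub : ∑ A, ∑ A', γ A A' * (∑ i, s A' i * (x' i - xbar i))
      ≤ ∑ A, ∑ A', γ A A' * g x' A' - ∑ A, ∑ A', γ A A' * g xbar A' := by
    rw [← Finset.sum_sub_distrib]
    refine Finset.sum_le_sum fun A _ => ?_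
    rw [← Finset.sum_sub_distrib]
    refine Finset.sum_le_sum fun A' _ => ?_
    have := mul_le_mul_of_nonneg_left (hs A' x' hx') (hγnn A A')
    linarith
  have hexp : ∑ i, (c i + ∑ A, ∑ A', γ A A' * s A' i) * (x' i - xbar i)
      = (∑ i, c i * x' i - ∑ i, c i * xbar i)
        + ∑ A, ∑ A', γ A A' * (∑ i, s A' i * (x' i - xbar i)) := by
    have h1 : ∑ A, ∑ A', γ A A' * (∑ i, s A' i * (x' i - xbar i))
        = ∑ i, (∑ A, ∑ A', γ A A' * s A' i) * (x' i - xbar i) := by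
      simp only [Finset.mul_sum, Finset.sum_mul]
      simp only [mul_assoc]
      conv_rhs => rw [Finset.sum_comm]
      refine Finset.sum_congr rfl fun A _ => ?_
      rw [Finset.sum_comm]
    rw [h1, ← Finset.sum_sub_distrib, ← Finset.sum_add_distrib]
    exact Finset.sum_congr rfl fun i _ => by ring
  rw [hexp] at h0
  constructor
  · rw [one_div, inv_mul_le_iff₀ hρ0]
    have : ρ * ((∑ i, c i * xbar i) + ∑ A, ∑ A', γ A A' * g xbar A')
        ≤ ρ * ((∑ i, c i * x' i) + Z x') :=
      mul_le_mul_of_nonneg_left (by linarith) hρ0.le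
    linarith
  · rw [div_le_iff₀ (by positivity)]
    have e : ∀ y : ℝ, 1 / ρ * y * (β * ρ) = β * y := fun y => by field_simp
    rw [e]
    have := mul_le_mul_of_nonneg_right hβ hC
    linarith
end

section
/- Let P ⊆ ℝ^m_{≥0}, suppose g(x,A) ≥ 0 for all x ∈ P and A ∈ 𝒜, let ζ_max := max_{A,A'∈𝒜} ζ(A,A') > 0, and assume 0 < r ≤ ζ_max. If there is a scenario A* ∈ 𝒜 with c·x + g(x,A*) ≥ 1 for every x ∈ P (A* is a non-null scenario), then for every probability distribution p on 𝒜 and every x ∈ P: h_p(x) ≥ r/ζ_max. -/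
open Finset

/-- If second-stage costs are nonnegative on `P`, `0 < r ≤ ζ_max`, and there
is a non-null scenario `A*` (i.e. `c·x + g(x,A*) ≥ 1` for all `x ∈ P`), then for every
probability distribution `p` and every `x ∈ P`, `h_p(x) ≥ r/ζ_max`. -/
theorem stmt6 {m : ℕ} {𝒜 : Type*} [Fintype 𝒜] [Nonempty 𝒜]
    (ζ : 𝒜 → 𝒜 → ℝ) (hζnn : ∀ A A', 0 ≤ ζ A A') (hζ0 : ∀ A, ζ A A = 0)
    (c : Fin m → ℝ) (hc : ∀ i, 0 ≤ c i)
    (g : (Fin m → ℝ) → 𝒜 → ℝ)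
    (P : Set (Fin m → ℝ)) (hPnn : ∀ x ∈ P, ∀ i, 0 ≤ x i)
    (hgnn : ∀ x ∈ P, ∀ A : 𝒜, 0 ≤ g x A)
    (ζmax : ℝ) (hζmax : IsGreatest {v | ∃ A A' : 𝒜, v = ζ A A'} ζmax)
    (hζmaxpos : 0 < ζmax)
    (r : ℝ) (hr : 0 < r) (hrζ : r ≤ ζmax)
    (Astar : 𝒜) (hAstar : ∀ x ∈ P, 1 ≤ (∑ i, c i * x i) + g x Astar) :
    ∀ p : 𝒜 → ℝ, (∀ A, 0 ≤ p A) → (∑ A, p A = 1) →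
      ∀ x ∈ P, ∀ Zval : ℝ,
        IsGreatest {v | ∃ γ : 𝒜 → 𝒜 → ℝ,
            (∀ A A', 0 ≤ γ A A') ∧ (∀ A, ∑ A', γ A A' ≤ p A) ∧
            (∑ A, ∑ A', ζ A A' * γ A A' ≤ r) ∧
            v = ∑ A, ∑ A', γ A A' * g x A'} Zval →
        r / ζmax ≤ (∑ i, c i * x i) + Zval := by
  classical
  intro p hp hp1 x hx Zval hZ
  have ht0 : 0 ≤ r / ζmax := by positivity
  have ht1 : r / ζmax ≤ 1 := (div_le_one hζmaxpos).2 hrζ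
  have htr : r / ζmax * ζmax = r := div_mul_cancel₀ _ hζmaxpos.ne'
  generalize r / ζmax = t at *
  have hcx : 0 ≤ ∑ i, c i * x i :=
    Finset.sum_nonneg fun i _ => mul_nonneg (hc i) (hPnn x hx i)
  have hZge : t * g x Astar ≤ Zval := by
    apply hZ.2
    refine ⟨fun A A' => if A' = Astar then t * p A else 0, ?_, ?_, ?_, ?_⟩
    · intro A A'
      dsimp only
      split_ifs
      · exact mul_nonneg ht0 (hp A)
      · exact le_rfl
    · intro A
      simp only [Finset.sum_ite_eq', Finset.mem_univ, if_true]
      exact mul_le_of_le_one_left (hp A) ht1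
    · simp only [mul_ite, mul_zero, Finset.sum_ite_eq', Finset.mem_univ, if_true]
      calc ∑ A, ζ A Astar * (t * p A) ≤ ∑ A, ζmax * (t * p A) :=
            Finset.sum_le_sum fun A _ =>
              mul_le_mul_of_nonneg_right (hζmax.2 ⟨A, Astar, rfl⟩) (mul_nonneg ht0 (hp A))
        _ = r := by
            rw [← Finset.mul_sum, ← Finset.mul_sum, hp1, mul_one, mul_comm, htr]
        _ ≤ r := le_rfl
    · simp only [ite_mul, zero_mul, Finset.sum_ite_eq', Finset.mem_univ, if_true]
      rw [← Finset.sum_mul, ← Finset.mul_sum, hp1, mul_one]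
  have h1 := mul_le_mul_of_nonneg_left (hAstar x hx) ht0
  have h2 := mul_le_mul_of_nonneg_right ht1 hcx
  linarith
end

section
/- Fix x ∈ ℝ^m, y ≥ 0, A ∈ 𝒜 and β ≥ 1, and let M := { ζ(A,A') : A' ∈ 𝒜 } (a finite set of values). Suppose that for each μ ∈ M there is a scenario A_μ ∈ 𝒜 with ζ(A,A_μ) ≤ μ and β·g(x,A_μ) ≥ g(x,A') for every A' ∈ 𝒜 with ζ(A,A') ≤ μ (a β-approximate solution of the constrained problem max{ g(x,A') : ζ(A,A') ≤ μ }). Let μ* ∈ M maximize μ ↦ g(x,A_μ) − y·ζ(A,A_μ) over M. Then for every A' ∈ 𝒜: g(x,A_{μ*}) − y·ζ(A,A_{μ*}) ≥ g(x,A')/β − y·ζ(A,A'); that is, A_{μ*} is a (β,1)-approximate solution of the problem max_{A'∈𝒜}( g(x,A') − y·ζ(A,A') ). -/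
open Finset

/-- Given a `β`-approximate solution `A_μ` to the constrained problem
`max{ g(x,A') : ζ(A,A') ≤ μ }` for every value `μ` in `M = {ζ(A,A') : A' ∈ 𝒜}`, the
scenario `A_{μ*}` maximizing `g(x,A_μ) − y·ζ(A,A_μ)` over `μ ∈ M` is a
`(β,1)`-approximate solution to `max_{A'}( g(x,A') − y·ζ(A,A') )`. -/
theorem stmt7 {m : ℕ} {𝒜 : Type*} [Fintype 𝒜] [Nonempty 𝒜]
    (ζ : 𝒜 → 𝒜 → ℝ) (hζnn : ∀ A A', 0 ≤ ζ A A') (hζ0 : ∀ A, ζ A A = 0)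
    (g : (Fin m → ℝ) → 𝒜 → ℝ) (hgnn : ∀ x A, 0 ≤ g x A)
    (x : Fin m → ℝ) (y : ℝ) (hy : 0 ≤ y) (A : 𝒜)
    (β : ℝ) (hβ : 1 ≤ β)
    (Asel : ℝ → 𝒜)
    (hsel : ∀ μ ∈ Finset.univ.image (fun A' => ζ A A'),
      ζ A (Asel μ) ≤ μ ∧ ∀ A' : 𝒜, ζ A A' ≤ μ → g x A' ≤ β * g x (Asel μ))
    (μstar : ℝ) (hμstar : μstar ∈ Finset.univ.image (fun A' => ζ A A'))
    (hbest : ∀ μ ∈ Finset.univ.image (fun A' => ζ A A'),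
      g x (Asel μ) - y * ζ A (Asel μ) ≤ g x (Asel μstar) - y * ζ A (Asel μstar)) :
    ∀ A' : 𝒜, g x A' / β - y * ζ A A' ≤ g x (Asel μstar) - y * ζ A (Asel μstar) := by
  intro A'
  have hm : ζ A A' ∈ Finset.univ.image (fun A' => ζ A A') :=
    Finset.mem_image_of_mem _ (Finset.mem_univ A')
  obtain ⟨h1, h2⟩ := hsel _ hm
  have h3 := h2 A' le_rfl
  have h4 : g x A' / β ≤ g x (Asel (ζ A A')) := by
    rw [div_le_iff₀ (by linarith)]
    linarith
  have h5 := mul_le_mul_of_nonneg_left h1 hy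
  have h6 := hbest _ hm
  linarith
end

section
/- Let U be a finite set and g : ℝ^m → (subsets of U) → ℝ be monotone in the scenario, i.e. g(x,A) ≤ g(x,A') whenever A ⊆ A' ⊆ U. Let ζ_disc be the discrete scenario metric: ζ_disc(A,A') = 0 if A = A' and 1 otherwise. Then for every x ∈ ℝ^m, every y ≥ 0 and every A ⊆ U: max_{A' ⊆ U}( g(x,A') − y·ζ_disc(A,A') ) = max( g(x,A), g(x,U) − y ). -/
open Finset

/-- For a scenario-monotone cost function `g` on subsets of a finite ground
set `U` and the discrete scenario metric, for every `x`, `y ≥ 0` and `A ⊆ U`,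
`max_{A' ⊆ U}( g(x,A') − y·ζ_disc(A,A') ) = max( g(x,A), g(x,U) − y )`. -/
theorem stmt8 {m : ℕ} {U : Type*} [Fintype U] [DecidableEq U]
    (g : (Fin m → ℝ) → Finset U → ℝ)
    (hmono : ∀ (x : Fin m → ℝ) (A A' : Finset U), A ⊆ A' → g x A ≤ g x A') :
    ∀ (x : Fin m → ℝ) (y : ℝ), 0 ≤ y → ∀ A : Finset U,
      (Finset.univ : Finset (Finset U)).sup' Finset.univ_nonempty
          (fun A' => g x A' - y * (if A = A' then (0 : ℝ) else 1)) =
        max (g x A) (g x Finset.univ - y) := by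
  intro x y hy A
  apply le_antisymm
  · apply Finset.sup'_le
    intro A' _
    by_cases h : A = A'
    · subst h
      simp
    · have h1 := hmono x A' Finset.univ (Finset.subset_univ A')
      apply le_max_of_le_right
      simp only [h, if_false]
      linarith
  · apply max_le
    · refine le_trans ?_ (Finset.le_sup' _ (Finset.mem_univ A))
      simp
    · refine le_trans ?_ (Finset.le_sup' _ (Finset.mem_univ (Finset.univ : Finset U)))
      show g x Finset.univ - y ≤
        g x Finset.univ - y * (if A = Finset.univ then (0 : ℝ) else 1)
      split_ifs <;> linarith
end

section
/- Let U be a finite set, δ : U × U → ℝ a nonnegative function, and for nonempty A ⊆ U and arbitrary A' ⊆ U define the asymmetric scenario distance ζ(A,A') := max_{j'∈A'} min_{j∈A} δ(j,j'), with ζ(A,∅) := 0. Let g : ℝ^m → (subsets of U) → ℝ be monotone in the scenario (A ⊆ A' ⇒ g(x,A) ≤ g(x,A')). Then for every x ∈ ℝ^m, every y ≥ 0 and every nonempty A ⊆ U, there exists μ ∈ { δ(j,j') : j,j' ∈ U } ∪ {0} such that the set A_μ := { j' ∈ U : min_{j∈A} δ(j,j') ≤ μ } satisfies g(x,A_μ)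 − y·ζ(A,A_μ) ≥ g(x,A') − y·ζ(A,A') for every A' ⊆ U; i.e., the polynomial-size family { A_μ } contains a maximizer of A' ↦ g(x,A') − y·ζ(A,A') over all subsets of U. -/
open Finset

open Classical in
/-- For the asymmetric scenario distance
`ζ(A,A') = max_{j'∈A'} min_{j∈A} δ(j,j')` (with `ζ(A,∅) = 0`) and a scenario-monotone
`g`, for every `x`, `y ≥ 0` and nonempty `A ⊆ U` there is a value
`μ ∈ {δ(j,j')} ∪ {0}` such that the threshold set
`A_μ = { j' : min_{j∈A} δ(j,j') ≤ μ }` maximizes `A' ↦ g(x,A') − y·ζ(A,A')`. -/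
theorem stmt9 {m : ℕ} {U : Type*} [Fintype U] [DecidableEq U]
    (δ : U → U → ℝ) (hδ : ∀ j j', 0 ≤ δ j j')
    (ζ : Finset U → Finset U → ℝ)
    (hζ : ∀ (A A' : Finset U) (hA : A.Nonempty),
      ζ A ∅ = 0 ∧
      ∀ hA' : A'.Nonempty,
        ζ A A' = A'.sup' hA' (fun j' => A.inf' hA (fun j => δ j j')))
    (g : (Fin m → ℝ) → Finset U → ℝ)
    (hmono : ∀ (x : Fin m → ℝ) (A A' : Finset U), A ⊆ A' → g x A ≤ g x A') :
    ∀ (x : Fin m → ℝ) (y : ℝ), 0 ≤ y → ∀ (A : Finset U) (hA : A.Nonempty),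
      ∃ μ : ℝ, (μ = 0 ∨ ∃ j j' : U, μ = δ j j') ∧
        ∀ A' : Finset U,
          g x A' - y * ζ A A' ≤
            g x (Finset.univ.filter (fun j' => A.inf' hA (fun j => δ j j') ≤ μ)) -
              y * ζ A (Finset.univ.filter (fun j' => A.inf' hA (fun j => δ j j') ≤ μ)) := by
  intro x y hy A hA
  obtain ⟨B, -, hB⟩ := Finset.exists_max_image (Finset.univ : Finset (Finset U))
    (fun A' => g x A' - y * ζ A A') Finset.univ_nonempty
  have hz0 : ζ A ∅ = 0 := (hζ A ∅ hA).1
  -- the optimal value of the distance is an admissible threshold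
  have hmem : ζ A B = 0 ∨ ∃ j j' : U, ζ A B = δ j j' := by
    rcases B.eq_empty_or_nonempty with h | h
    · left; rw [h, hz0]
    · right
      obtain ⟨j', -, h1⟩ := Finset.exists_mem_eq_sup' h (fun j' => A.inf' hA (fun j => δ j j'))
      obtain ⟨j, -, h2⟩ := Finset.exists_mem_eq_inf' hA (fun j => δ j j')
      exact ⟨j, j', ((hζ A B hA).2 h).trans (h1.trans h2)⟩
  have hnn : 0 ≤ ζ A B := by
    rcases hmem with h | ⟨j, j', h⟩
    · exact h.ge
    · rw [h]; exact hδ j j'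
  refine ⟨ζ A B, hmem, fun A' => (hB A' (Finset.mem_univ _)).trans ?_⟩
  have hsub : B ⊆ Finset.univ.filter (fun j' => A.inf' hA (fun j => δ j j') ≤ ζ A B) := by
    intro b hb
    refine Finset.mem_filter.2 ⟨Finset.mem_univ _, ?_⟩
    rw [(hζ A B hA).2 ⟨b, hb⟩]
    exact Finset.le_sup' (fun j' => A.inf' hA (fun j => δ j j')) hb
  have hle : ζ A (Finset.univ.filter (fun j' => A.inf' hA (fun j => δ j j') ≤ ζ A B))
      ≤ ζ A B := by
    rcases (Finset.univ.filter
      (fun j' => A.inf' hA (fun j => δ j j') ≤ ζ A B)).eq_empty_or_nonempty with h | h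
    · rw [h, hz0]; exact hnn
    · rw [(hζ A _ hA).2 h]
      exact Finset.sup'_le _ _ fun b hb => (Finset.mem_filter.1 hb).2
  exact sub_le_sub (hmono x _ _ hsub) (mul_le_mul_of_nonneg_left hle hy)
end

section
/- Assume ξ is cross-monotone. Then for every J ⊆ C, every j₁ ∈ J and every j₂ ∈ C∖J: ξ(J∪{j₂}, j₁) ≥ min( ξ(J, j₁), ξ(J∪{j₂}, j₂) ). -/
open Finset

/-- For the Pál–Tardos cost-sharing method
`ξ(J,j) = min_{i∈F} max(t(J,i), δ(i,j))`, if `ξ` is cross-monotone then for every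
`J ⊆ C`, `j₁ ∈ J` and `j₂ ∉ J`:
`ξ(J∪{j₂}, j₁) ≥ min( ξ(J,j₁), ξ(J∪{j₂}, j₂) )`. -/
theorem stmt10 {F C : Type*} [Fintype F] [Nonempty F] [Fintype C] [DecidableEq C]
    (δ : F → C → ℝ) (hδ : ∀ i j, 0 ≤ δ i j)
    (t : Finset C → F → ℝ) (htnn : ∀ J i, 0 ≤ t J i)
    (ht1 : ∀ (J : Finset C) (j : C), j ∉ J → ∀ i : F, t (insert j J) i ≤ t J i)
    (ht2 : ∀ (J : Finset C) (j : C), j ∉ J → ∀ i : F,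
      t (insert j J) i < t J i → δ i j ≤ t (insert j J) i)
    (ξ : Finset C → C → ℝ)
    (hξ : ∀ (J : Finset C) (j : C),
      ξ J j = Finset.univ.inf' Finset.univ_nonempty (fun i : F => max (t J i) (δ i j)))
    (hcross : ∀ (J₁ J₂ : Finset C), J₁ ⊆ J₂ → ∀ j : C, ξ J₂ j ≤ ξ J₁ j) :
    ∀ (J : Finset C) (j₁ : C), j₁ ∈ J → ∀ j₂ : C, j₂ ∉ J →
      min (ξ J j₁) (ξ (insert j₂ J) j₂) ≤ ξ (insert j₂ J) j₁ := by
  intro J j₁ _ j₂ hj₂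
  rw [hξ (insert j₂ J) j₁]
  refine Finset.le_inf' _ _ (fun i _ => ?_)
  have key : ∀ (K : Finset C) (j : C), ξ K j ≤ max (t K i) (δ i j) := by
    intro K j
    rw [hξ K j]
    exact Finset.inf'_le (fun i : F => max (t K i) (δ i j)) (Finset.mem_univ i)
  rcases (ht1 J j₂ hj₂ i).lt_or_eq with h | h
  · have h2 := ht2 J j₂ hj₂ i h
    refine (min_le_right _ _).trans ((key _ _).trans ?_)
    rw [max_eq_left h2]
    exact le_max_left _ _
  · refine (min_le_left _ _).trans ((key _ _).trans ?_)
    rw [h]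
end

section
/- Let λ ≥ 1 and define the thresholded objective ḡ(x,y,A) := max{ g(x,A') − y·ζ(A,A') : A' ∈ 𝒜, ζ(A,A') ≤ λ·r } (the maximum is over a nonempty set since ζ(A,A) = 0 ≤ λr). Let X ⊆ ℝ^m_{≥0} with 0 ∈ X, and suppose that for all x ∈ X and A ∈ 𝒜: 0 ≤ g(x,A) ≤ g(0,A) (property (P1)) and g(0,A) ≤ g(x,A) + λ·(c·x) (property (P2)). Then for all x ∈ X, y ≥ 0 and A ∈ 𝒜: ḡ(x,y,A) ≤ ḡ(0,0,A) ≤ ḡ(x,y,A) + λ·(c·x + r·y). -/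
open Finset

/-- For the thresholded objective
`ḡ(x,y,A) = max{ g(x,A') − y·ζ(A,A') : ζ(A,A') ≤ λ·r }`, under properties (P1) and (P2)
one has, for all `x ∈ X`, `y ≥ 0`, and scenarios `A`:
`ḡ(x,y,A) ≤ ḡ(0,0,A) ≤ ḡ(x,y,A) + λ·(c·x + r·y)`. -/
theorem stmt13 {m : ℕ} {𝒜 : Type*} [Fintype 𝒜] [Nonempty 𝒜]
    (ζ : 𝒜 → 𝒜 → ℝ) (hζnn : ∀ A A', 0 ≤ ζ A A') (hζ0 : ∀ A, ζ A A = 0)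
    (r : ℝ) (hr : 0 < r)
    (c : Fin m → ℝ) (hc : ∀ i, 0 ≤ c i)
    (g : (Fin m → ℝ) → 𝒜 → ℝ)
    (lam : ℝ) (hlam : 1 ≤ lam)
    (X : Set (Fin m → ℝ)) (hXnn : ∀ x ∈ X, ∀ i, 0 ≤ x i) (hX0 : (0 : Fin m → ℝ) ∈ X)
    (hP1 : ∀ x ∈ X, ∀ A : 𝒜, 0 ≤ g x A ∧ g x A ≤ g 0 A)
    (hP2 : ∀ x ∈ X, ∀ A : 𝒜, g 0 A ≤ g x A + lam * ∑ i, c i * x i)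
    (gbar : (Fin m → ℝ) → ℝ → 𝒜 → ℝ)
    (hgbar : ∀ (x : Fin m → ℝ) (y : ℝ) (A : 𝒜),
      IsGreatest {v | ∃ A' : 𝒜, ζ A A' ≤ lam * r ∧ v = g x A' - y * ζ A A'}
        (gbar x y A)) :
    ∀ x ∈ X, ∀ y : ℝ, 0 ≤ y → ∀ A : 𝒜,
      gbar x y A ≤ gbar 0 0 A ∧
      gbar 0 0 A ≤ gbar x y A + lam * ((∑ i, c i * x i) + r * y) := by
  intro x hx y hy A
  constructor
  · obtain ⟨B, hB, hv⟩ := (hgbar x y A).1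
    have h := (hgbar 0 0 A).2 ⟨B, hB, rfl⟩
    have h1 := (hP1 x hx B).2
    have h2 := mul_nonneg hy (hζnn A B)
    linarith
  · obtain ⟨B, hB, hv⟩ := (hgbar 0 0 A).1
    have h := (hgbar x y A).2 ⟨B, hB, rfl⟩
    have h1 := hP2 x hx B
    have h2 := mul_le_mul_of_nonneg_left hB hy
    rw [mul_add]
    linarith
end

section
/- Let 𝒜 be a finite nonempty set, let p and p̂ be probability distributions on 𝒜, let 0 < r ≤ 1 and ε' > 0. Suppose 𝒜 is partitioned as 𝒜 = Â_freq ∪ Â_rare (disjoint) with { A ∈ 𝒜 : p_A ≥ r } ⊆ Â_freq, and ∑_{A∈Â_freq} |p̂_A − p_A| ≤ (1/4)·ε'·r. Define Q := ∑_{A∈Â_freq} min(p̂_A, r) + ∑_{A∈Â_rare} p̂_A and P̂_free := min( Q + (1/2)·ε'·r, 1 ). Then P_free ≤ P̂_free ≤ min( (1+ε')·P_free, 1 ), where P_free := ∑_{A∈𝒜} min(p_A, r). -/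
open Finset

/-- If `Â_freq ∪ Â_rare` partitions `𝒜` with all frequent scenarios of `p`
in `Â_freq`, and `p̂` is close to `p` on `Â_freq` (total deviation at most `ε'r/4`), then
`P̂_free := min(Q + ε'r/2, 1)` with
`Q := ∑_{A∈Â_freq} min(p̂_A,r) + ∑_{A∈Â_rare} p̂_A` satisfies
`P_free ≤ P̂_free ≤ min((1+ε')·P_free, 1)`. -/
theorem stmt15 {𝒜 : Type*} [Fintype 𝒜] [Nonempty 𝒜] [DecidableEq 𝒜]
    (p phat : 𝒜 → ℝ)
    (hp : ∀ A, 0 ≤ p A) (hp1 : ∑ A, p A = 1)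
    (hphat : ∀ A, 0 ≤ phat A) (hphat1 : ∑ A, phat A = 1)
    (r : ℝ) (hr0 : 0 < r) (hr1 : r ≤ 1)
    (ε : ℝ) (hε : 0 < ε)
    (Afreq Arare : Finset 𝒜)
    (hdisj : Disjoint Afreq Arare) (hunion : Afreq ∪ Arare = Finset.univ)
    (hfreq : ∀ A : 𝒜, r ≤ p A → A ∈ Afreq)
    (hclose : ∑ A ∈ Afreq, |phat A - p A| ≤ (1 / 4) * ε * r) :
    (∑ A, min (p A) r) ≤
        min ((∑ A ∈ Afreq, min (phat A) r + ∑ A ∈ Arare, phat A) + (1 / 2) * ε * r) 1 ∧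
    min ((∑ A ∈ Afreq, min (phat A) r + ∑ A ∈ Arare, phat A) + (1 / 2) * ε * r) 1 ≤
        min ((1 + ε) * ∑ A, min (p A) r) 1 := by
  have split : ∀ f : 𝒜 → ℝ, ∑ A, f A = ∑ A ∈ Afreq, f A + ∑ A ∈ Arare, f A := by
    intro f
    rw [← hunion, Finset.sum_union hdisj]
  have hP1 : ∑ A, min (p A) r ≤ 1 := by
    rw [← hp1]
    exact Finset.sum_le_sum fun A _ => min_le_left _ _
  have hrP : r ≤ ∑ A, min (p A) r := by
    by_cases h : ∃ A, r ≤ p A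
    · obtain ⟨A, hA⟩ := h
      have h1 := Finset.single_le_sum (f := fun A => min (p A) r)
        (fun B _ => le_min (hp B) hr0.le) (Finset.mem_univ A)
      simp only [min_eq_right hA] at h1
      exact h1
    · push Not at h
      have h1 : ∑ A, min (p A) r = ∑ A, p A :=
        Finset.sum_congr rfl fun A _ => min_eq_left (h A).le
      rw [h1, hp1]
      exact hr1
  have hrare : ∑ A ∈ Arare, min (p A) r = ∑ A ∈ Arare, p A := by
    refine Finset.sum_congr rfl fun A hA => min_eq_left ?_
    by_contra hlt
    push Not at hlt
    exact Finset.disjoint_left.mp hdisj (hfreq A hlt.le) hA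
  have e1 := split p
  have e2 := split phat
  have e3 := split (fun A => min (p A) r)
  have hmin : ∀ a b : ℝ, |min a r - min b r| ≤ |a - b| := fun a b => by
    simpa using abs_min_sub_min_le_max a r b r
  have a1 : |∑ A ∈ Afreq, (phat A - p A)| ≤ (1 / 4) * ε * r :=
    (Finset.abs_sum_le_sum_abs _ _).trans hclose
  have a2 : |∑ A ∈ Afreq, (min (phat A) r - min (p A) r)| ≤ (1 / 4) * ε * r :=
    ((Finset.abs_sum_le_sum_abs _ _).trans
      (Finset.sum_le_sum fun A _ => hmin _ _)).trans hclose
  rw [Finset.sum_sub_distrib, abs_le] at a1 a2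
  have hεr : ε * r ≤ ε * ∑ A, min (p A) r := mul_le_mul_of_nonneg_left hrP hε.le
  refine ⟨le_min ?_ hP1, min_le_min_right 1 ?_⟩
  · linarith [a1.1, a1.2, a2.1, a2.2]
  · rw [add_mul, one_mul]
    linarith [a1.1, a1.2, a2.1, a2.2]
end

section
/- Let 𝒜 be a finite nonempty set, p a probability distribution on 𝒜, 0 < r ≤ 1, ε ≥ 0, and g : 𝒜 → ℝ with g ≥ 0. Let P_free := ∑_{A∈𝒜} min(p_A, r) and let P̂ ≥ 0 satisfy P̂ ≤ (1+ε)·P_free. Define K := { q : 𝒜 → ℝ : 0 ≤ q_A ≤ r for all A, ∑_A q_A ≤ P̂ }. Then max{ ∑_A q_A·g_A : q a probability distribution on 𝒜 with max_{A}|p_A − q_A| ≤ r } ≥ (1/(1+ε))·max{ ∑_A q_A·g_A : q ∈ K } (both maxima exist, being maxima of a linear function over nonempty compact sets). -/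
open Finset

/-- With `P̂ ≤ (1+ε)·P_free` and
`K = { q : 0 ≤ q ≤ r, ∑ q ≤ P̂ }`, the maximum of `∑ q_A g_A` over the `L∞`-ball of
radius `r` around `p` is at least `1/(1+ε)` times the maximum over `K`. -/
theorem stmt16 {𝒜 : Type*} [Fintype 𝒜] [Nonempty 𝒜]
    (p : 𝒜 → ℝ) (hp : ∀ A, 0 ≤ p A) (hp1 : ∑ A, p A = 1)
    (r : ℝ) (hr0 : 0 < r) (hr1 : r ≤ 1)
    (ε : ℝ) (hε : 0 ≤ ε)
    (g : 𝒜 → ℝ) (hg : ∀ A, 0 ≤ g A)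
    (Phat : ℝ) (hPhat0 : 0 ≤ Phat)
    (hPhat : Phat ≤ (1 + ε) * ∑ A, min (p A) r)
    (V W : ℝ)
    (hV : IsGreatest {v | ∃ q : 𝒜 → ℝ,
        (∀ A, 0 ≤ q A) ∧ (∑ A, q A = 1) ∧ (∀ A, |p A - q A| ≤ r) ∧
        v = ∑ A, q A * g A} V)
    (hW : IsGreatest {v | ∃ q : 𝒜 → ℝ,
        (∀ A, 0 ≤ q A ∧ q A ≤ r) ∧ (∑ A, q A ≤ Phat) ∧
        v = ∑ A, q A * g A} W) :
    (1 / (1 + ε)) * W ≤ V := by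
  obtain ⟨q, hq, hqs, rfl⟩ := hW.1
  have he : 0 < 1 + ε := by linarith
  set F := ∑ A, min (p A) r with hF
  have hc : 0 < 1 / (1 + ε) := by positivity
  have hc1 : 1 / (1 + ε) ≤ 1 := by
    rw [div_le_one he]; linarith
  have hce : 1 / (1 + ε) * (1 + ε) = 1 := by field_simp
  set c := 1 / (1 + ε) with hcdef
  have hq0 : ∀ A, 0 ≤ c * q A := fun A => mul_nonneg hc.le (hq A).1
  have hqr : ∀ A, c * q A ≤ r := fun A => by nlinarith [(hq A).1, (hq A).2]
  have hSF : ∑ A, c * q A ≤ F := by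
    rw [← Finset.mul_sum]
    calc c * ∑ A, q A ≤ c * ((1 + ε) * F) :=
          mul_le_mul_of_nonneg_left (hqs.trans hPhat) hc.le
      _ = F := by rw [← mul_assoc, hce, one_mul]
  have hFN : F ≤ ∑ _A : 𝒜, r := Finset.sum_le_sum fun A _ => min_le_right _ _
  obtain ⟨l, hl0, hl1, hl⟩ : ∃ l : ℝ, 0 ≤ l ∧ l ≤ 1 ∧
      l * ((∑ _A : 𝒜, r) - ∑ A, c * q A) = F - ∑ A, c * q A := by
    rcases eq_or_lt_of_le (hSF.trans hFN) with h | h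
    · exact ⟨0, le_rfl, zero_le_one, by linarith⟩
    · have h' : 0 < (∑ _A : 𝒜, r) - ∑ A, c * q A := by linarith
      refine ⟨(F - ∑ A, c * q A) / ((∑ _A : 𝒜, r) - ∑ A, c * q A), ?_, ?_, ?_⟩
      · exact div_nonneg (by linarith) h'.le
      · rw [div_le_one h']; linarith
      · exact div_mul_cancel₀ _ h'.ne'
  have ht : ∀ A, c * q A ≤ c * q A + l * (r - c * q A) ∧
      c * q A + l * (r - c * q A) ≤ r := fun A => by
    have := hqr A
    constructor <;> nlinarith
  have hm : ∀ A, 0 ≤ min (p A) r ∧ min (p A) r ≤ p A ∧ min (p A) r ≤ r := fun A =>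
    ⟨le_min (hp A) hr0.le, min_le_left _ _, min_le_right _ _⟩
  have key := hV.2 ⟨fun A => p A - min (p A) r + (c * q A + l * (r - c * q A)),
    fun A => by linarith [hm A, ht A, hq0 A], ?_, fun A => ?_, rfl⟩
  · refine le_trans ?_ key
    rw [Finset.mul_sum]
    refine Finset.sum_le_sum fun A _ => ?_
    rw [← mul_assoc]
    exact mul_le_mul_of_nonneg_right (by linarith [hm A, ht A]) (hg A)
  · simp only [Finset.sum_add_distrib, Finset.sum_sub_distrib, ← Finset.mul_sum] at hl ⊢
    linarith
  · rw [abs_le]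
    constructor <;> linarith [hm A, ht A, hq0 A]
end

section
/- Let 𝒜 be a finite nonempty set, p a probability distribution on 𝒜, 0 < r ≤ 1, ε ≥ 0, and g : 𝒜 → ℝ with g ≥ 0. Let P_free := ∑_{A∈𝒜} min(p_A, r) and let P̂ satisfy P_free ≤ P̂ ≤ (1+ε)·P_free. Define K := { q : 𝒜 → ℝ : 0 ≤ q_A ≤ r for all A, ∑_A q_A ≤ P̂ }, V := max{ ∑_A q_A·g_A : q a probability distribution on 𝒜 with max_A|p_A − q_A| ≤ r }, E := ∑_A p_A·g_A, and W := max{ ∑_A q_A·g_A : q ∈ K }. Then V ≤ E + W ≤ 2(1+ε)·V; consequently, for any x ∈ ℝ^m with c·x ≥ 0, c·x + V ≤ c·x + E + W ≤ 2(1+ε)·(c·x + V), i.e. the proxy objective is pointwise within a factor 2(1+ε) of the true objective. -/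
open Finset

/-- With `P_free ≤ P̂ ≤ (1+ε)·P_free`,
`V = max over the L∞-ball`, `E = ∑ p_A g_A`, and `W = max over K`, one has
`V ≤ E + W ≤ 2(1+ε)·V`; consequently for any `x` with `c·x ≥ 0`,
`c·x + V ≤ c·x + E + W ≤ 2(1+ε)(c·x + V)`. -/
theorem stmt17 {𝒜 : Type*} [Fintype 𝒜] [Nonempty 𝒜]
    (p : 𝒜 → ℝ) (hp : ∀ A, 0 ≤ p A) (hp1 : ∑ A, p A = 1)
    (r : ℝ) (hr0 : 0 < r) (hr1 : r ≤ 1)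
    (ε : ℝ) (hε : 0 ≤ ε)
    (g : 𝒜 → ℝ) (hg : ∀ A, 0 ≤ g A)
    (Phat : ℝ)
    (hPhatlb : (∑ A, min (p A) r) ≤ Phat)
    (hPhatub : Phat ≤ (1 + ε) * ∑ A, min (p A) r)
    (V W : ℝ)
    (hV : IsGreatest {v | ∃ q : 𝒜 → ℝ,
        (∀ A, 0 ≤ q A) ∧ (∑ A, q A = 1) ∧ (∀ A, |p A - q A| ≤ r) ∧
        v = ∑ A, q A * g A} V)
    (hW : IsGreatest {v | ∃ q : 𝒜 → ℝ,
        (∀ A, 0 ≤ q A ∧ q A ≤ r) ∧ (∑ A, q A ≤ Phat) ∧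
        v = ∑ A, q A * g A} W) :
    (V ≤ (∑ A, p A * g A) + W ∧ (∑ A, p A * g A) + W ≤ 2 * (1 + ε) * V) ∧
    ∀ {m : ℕ} (c x : Fin m → ℝ), 0 ≤ ∑ i, c i * x i →
      (∑ i, c i * x i) + V ≤ (∑ i, c i * x i) + (∑ A, p A * g A) + W ∧
      (∑ i, c i * x i) + (∑ A, p A * g A) + W ≤
        2 * (1 + ε) * ((∑ i, c i * x i) + V) := by
  have hE0 : 0 ≤ ∑ A, p A * g A := sum_nonneg fun A _ => mul_nonneg (hp A) (hg A)
  have hEV : ∑ A, p A * g A ≤ V :=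
    hV.2 ⟨p, hp, hp1, fun A => by simpa using hr0.le, rfl⟩
  have h1 : V ≤ (∑ A, p A * g A) + W := by
    obtain ⟨q, hq0, hq1, hqr, rfl⟩ := hV.1
    have hd : ∑ A, max (q A - p A) 0 * g A ≤ W := by
      refine hW.2 ⟨fun A => max (q A - p A) 0, fun A => ⟨le_max_right _ _, ?_⟩, ?_, rfl⟩
      · have := abs_le.1 (hqr A)
        exact max_le (by linarith) hr0.le
      · refine le_trans ?_ hPhatlb
        have e : ∑ A, max (q A - p A) 0 = ∑ A, (max (q A - p A) 0 - (q A - p A)) := by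
          simp only [sum_sub_distrib, hq1, hp1]; ring
        rw [e]
        refine sum_le_sum fun A _ => ?_
        have := abs_le.1 (hqr A)
        have h3 := hq0 A
        have h4 := hp A
        refine le_min ?_ ?_
        · have : max (q A - p A) 0 ≤ q A := max_le (by linarith) h3
          linarith
        · have : max (q A - p A) 0 ≤ r + (q A - p A) := max_le (by linarith) (by linarith)
          linarith
    refine le_trans ?_ (add_le_add_right hd _)
    rw [← sum_add_distrib]
    refine sum_le_sum fun A _ => ?_
    rw [← add_mul]
    refine mul_le_mul_of_nonneg_right ?_ (hg A)
    have := le_max_left (q A - p A) 0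
    linarith
  have hε1 : 0 < 1 + ε := by linarith
  have hF : 0 < ∑ A, min (p A) r := by
    have h0 : ∀ A, 0 ≤ min (p A) r := fun A => le_min (hp A) hr0.le
    obtain ⟨A, -, hA⟩ : ∃ A ∈ (univ : Finset 𝒜), 0 < p A := by
      by_contra! h
      have := sum_nonpos h
      linarith
    exact sum_pos' (fun A _ => h0 A) ⟨A, mem_univ A, lt_min hA hr0⟩
  have h2 : W ≤ (1 + ε) * V := by
    obtain ⟨q, hq, hqs, rfl⟩ := hW.1
    set F := ∑ A, min (p A) r with hFdef
    set S := ∑ A, q A / (1 + ε) with hS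
    have hS0 : 0 ≤ S := sum_nonneg fun A _ => div_nonneg (hq A).1 hε1.le
    have hSF : S ≤ F := by
      rw [hS, ← sum_div, div_le_iff₀ hε1]
      linarith
    have ht0 : 0 ≤ S / F := div_nonneg hS0 hF.le
    have ht1 : S / F ≤ 1 := (div_le_one hF).2 hSF
    have hb : ∀ A, 0 ≤ S / F * min (p A) r ∧ S / F * min (p A) r ≤ min (p A) r := fun A => by
      have h0 : 0 ≤ min (p A) r := le_min (hp A) hr0.le
      exact ⟨mul_nonneg ht0 h0, mul_le_of_le_one_left h0 ht1⟩
    have hq' : ∀ A, 0 ≤ q A / (1 + ε) ∧ q A / (1 + ε) ≤ r := fun A =>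
      ⟨div_nonneg (hq A).1 hε1.le, (div_le_self (hq A).1 (by linarith)).trans (hq A).2⟩
    have hv : ∑ A, (p A - S / F * min (p A) r + q A / (1 + ε)) * g A ≤ V := by
      refine hV.2 ⟨_, fun A => ?_, ?_, fun A => ?_, rfl⟩
      · have := hb A
        have := hq' A
        have := min_le_left (p A) r
        linarith
      · rw [sum_add_distrib, sum_sub_distrib, ← mul_sum, ← hS, ← hFdef, hp1,
          div_mul_cancel₀ _ hF.ne']
        ring
      · have := hb A
        have := hq' A
        have := min_le_right (p A) r
        rw [abs_le]
        constructor <;> linarith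
    have hv2 : ∑ A, q A / (1 + ε) * g A ≤ V := by
      refine le_trans (sum_le_sum fun A _ => mul_le_mul_of_nonneg_right ?_ (hg A)) hv
      have := hb A
      have := min_le_left (p A) r
      linarith
    have e : ∑ A, q A * g A = (1 + ε) * ∑ A, q A / (1 + ε) * g A := by
      rw [mul_sum]
      refine sum_congr rfl fun A _ => ?_
      field_simp
    rw [e]
    exact mul_le_mul_of_nonneg_left hv2 hε1.le
  have hεV : 0 ≤ ε * V := mul_nonneg hε (hE0.trans hEV)
  refine ⟨⟨h1, by linarith⟩, fun c x hc => ⟨by linarith, ?_⟩⟩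
  have := mul_nonneg hε hc
  linarith
end

section
/- Let x̄ : 𝒮 → [0,1] be a fractional first-stage set-cover solution, let S_x̄ := { e ∈ U : ∑_{S∈𝒮, e∈S} x̄_S ≥ 1/2 } be the set of elements covered to extent at least 1/2 by x̄, and let x̃ := ( min(2·x̄_S, 1) )_{S∈𝒮}. Then for every A ⊆ U: (a) g(x̃, A) ≤ g(0, A∖S_x̄); and (b) g(x̄, A∖S_x̄) ≥ (1/2)·g(0, A∖S_x̄). -/
open Finset

open Classical in
/-- for fractional set cover with second-stage costs
`g(x,A) = min{ ∑ w_S z_S : z ≥ 0, x + z fractionally covers A }`, letting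
`S_x̄` be the elements covered to extent at least `1/2` by `x̄` and
`x̃ := min(2x̄, 1)`, for every `A ⊆ U`:
(a) `g(x̃,A) ≤ g(0, A∖S_x̄)`, and (b) `g(x̄, A∖S_x̄) ≥ (1/2)·g(0, A∖S_x̄)`. -/
theorem stmt19 {U 𝒮 : Type*} [Fintype U] [DecidableEq U] [Fintype 𝒮]
    (sets : 𝒮 → Finset U) (hcover : ∀ e : U, ∃ S : 𝒮, e ∈ sets S)
    (w : 𝒮 → ℝ) (hw : ∀ S, 0 ≤ w S)
    (g : (𝒮 → ℝ) → Finset U → ℝ)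
    (hg : ∀ x : 𝒮 → ℝ, (∀ S, 0 ≤ x S) → ∀ A : Finset U,
      IsLeast {v | ∃ z : 𝒮 → ℝ, (∀ S, 0 ≤ z S) ∧
        (∀ e ∈ A, 1 ≤ ∑ S ∈ Finset.univ.filter (fun S => e ∈ sets S), (x S + z S)) ∧
        v = ∑ S, w S * z S} (g x A))
    (xbar : 𝒮 → ℝ) (hxbar : ∀ S, 0 ≤ xbar S ∧ xbar S ≤ 1) :
    let Sxbar : Finset U := Finset.univ.filter
      (fun e => (1 : ℝ) / 2 ≤ ∑ S ∈ Finset.univ.filter (fun S => e ∈ sets S), xbar S)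
    let xtil : 𝒮 → ℝ := fun S => min (2 * xbar S) 1
    ∀ A : Finset U,
      g xtil A ≤ g 0 (A \ Sxbar) ∧
      (1 / 2) * g 0 (A \ Sxbar) ≤ g xbar (A \ Sxbar) := by
  intro Sxbar xtil A
  have hx0 : ∀ S, 0 ≤ xtil S := fun S =>
    le_min (mul_nonneg zero_le_two (hxbar S).1) zero_le_one
  constructor
  · obtain ⟨⟨z, hz, hc, hv⟩, -⟩ := hg 0 (fun S => le_refl _) (A \ Sxbar)
    refine (hg xtil hx0 A).2 ⟨z, hz, ?_, hv⟩
    intro e he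
    by_cases hs : e ∈ Sxbar
    · have hs' := (Finset.mem_filter.1 hs).2
      have h1 : 1 ≤ ∑ S ∈ Finset.univ.filter (fun S => e ∈ sets S), xtil S := by
        by_cases hbig : ∃ S, e ∈ sets S ∧ 1 ≤ 2 * xbar S
        · obtain ⟨T, hT, hb⟩ := hbig
          have h2 : xtil T = 1 := min_eq_right hb
          rw [← h2]
          exact Finset.single_le_sum (f := xtil) (fun S _ => hx0 S)
            (Finset.mem_filter.2 ⟨Finset.mem_univ _, hT⟩)
        · push Not at hbig
          have h2 : ∑ S ∈ Finset.univ.filter (fun S => e ∈ sets S), xtil S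
              = ∑ S ∈ Finset.univ.filter (fun S => e ∈ sets S), 2 * xbar S :=
            Finset.sum_congr rfl fun S hS =>
              min_eq_left (hbig S (Finset.mem_filter.1 hS).2).le
          rw [h2, ← Finset.mul_sum]
          linarith
      refine h1.trans (Finset.sum_le_sum fun S _ => ?_)
      linarith [hz S]
    · refine (hc e (Finset.mem_sdiff.2 ⟨he, hs⟩)).trans (Finset.sum_le_sum fun S _ => ?_)
      have := hx0 S
      simp only [Pi.zero_apply]
      linarith
  · obtain ⟨⟨z, hz, hc, hv⟩, -⟩ := hg xbar (fun S => (hxbar S).1) (A \ Sxbar)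
    have key : g 0 (A \ Sxbar) ≤ 2 * g xbar (A \ Sxbar) := by
      refine (hg 0 (fun S => le_refl _) (A \ Sxbar)).2 ⟨fun S => 2 * z S, ?_, ?_, ?_⟩
      · intro S
        have := hz S
        positivity
      · intro e he
        have h1 := hc e he
        have h2 : ∑ S ∈ Finset.univ.filter (fun S => e ∈ sets S), xbar S < 1 / 2 := by
          by_contra hcon
          exact (Finset.mem_sdiff.1 he).2
            (Finset.mem_filter.2 ⟨Finset.mem_univ _, not_lt.1 hcon⟩)
        rw [Finset.sum_add_distrib] at h1
        simp only [Pi.zero_apply, zero_add]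
        rw [← Finset.mul_sum]
        linarith
      · rw [hv, Finset.mul_sum]
        exact Finset.sum_congr rfl fun S _ => by ring
    linarith
end
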